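/- arXiv:1803.06324 — 5 statements merged into one kernel-verified Lean document; each statement's English description precedes it below -/
import Mathlib

section
/- For every finite connected graph G, ς(G) ≤ ι(G) = τ(G) ≤ 4·ς(G). -/
open SimpleGraph

noncomputable section

namespace HypPaper

variable {V : Type*}

/-- Gromov product `(y|z)_w = (d(y,w)+d(z,w)-d(y,z))/2`. -/
def gp (G : SimpleGraph V) (y z w : V) : ℝ :=
  ((G.dist y w : ℝ) + (G.dist z w : ℝ) - (G.dist y z : ℝ)) / 2

/-- `G` is `δ`-hyperbolic. -/
def IsDeltaHyp (G : SimpleGraph V) (δ : ℝ) : Prop :=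
  ∀ w x y z : V, gp G x y w ≥ min (gp G x z w) (gp G y z w) - δ

/-- The hyperbolicity `δ(G)`: least `δ ≥ 0` such that `G` is `δ`-hyperbolic. -/
def hyperbolicity (G : SimpleGraph V) : ℝ :=
  sInf {δ : ℝ | 0 ≤ δ ∧ IsDeltaHyp G δ}

/-- Pointed hyperbolicity `δ_w(G)` with respect to basepoint `w`. -/
def pointedHyp (G : SimpleGraph V) (w : V) : ℝ :=
  sInf {δ : ℝ | ∀ x y z : V, gp G x y w ≥ min (gp G x z w) (gp G y z w) - δ}

/-- A walk is a geodesic (shortest path) if its length equals the distance. -/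
def IsGeodesic (G : SimpleGraph V) {x y : V} (p : G.Walk x y) : Prop :=
  p.length = G.dist x y

/-- Thinness condition at corner `v` of a triangle, with sides `p : v → u` and `q : v → u'`. -/
def ThinCorner (G : SimpleGraph V) (δ : ℝ) {v u u' : V}
    (p : G.Walk v u) (q : G.Walk v u') : Prop :=
  ∀ a ∈ p.support, ∀ b ∈ q.support,
    G.dist v a = G.dist v b → (G.dist v a : ℝ) ≤ gp G u u' v →
    (G.dist a b : ℝ) ≤ δ

/-- A geodesic triangle with sides `p : x → y`, `q : y → z`, `r : z → x` is `δ`-thin. -/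
def TriangleThin (G : SimpleGraph V) (δ : ℝ) {x y z : V}
    (p : G.Walk x y) (q : G.Walk y z) (r : G.Walk z x) : Prop :=
  ThinCorner G δ p r.reverse ∧ ThinCorner G δ q p.reverse ∧ ThinCorner G δ r q.reverse

/-- Thinness `τ(G)`: least `δ` such that every geodesic triangle is `δ`-thin. -/
def thinness (G : SimpleGraph V) : ℝ :=
  sInf {δ : ℝ | ∀ (x y z : V) (p : G.Walk x y) (q : G.Walk y z) (r : G.Walk z x),
    IsGeodesic G p → IsGeodesic G q → IsGeodesic G r → TriangleThin G δ p q r}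

/-- The insize `max {d(y_z,z_y), d(z_x,x_z), d(x_y,y_x)}` of a geodesic triangle with
sides `p : x → y`, `q : y → z`, `r : z → x`. -/
def triInsize (G : SimpleGraph V) {x y z : V}
    (p : G.Walk x y) (q : G.Walk y z) (r : G.Walk z x) : ℝ :=
  max (G.dist (p.getVert ⌊gp G y z x⌋₊) (r.reverse.getVert ⌊gp G y z x⌋₊) : ℝ)
    (max (G.dist (q.getVert ⌊gp G z x y⌋₊) (p.reverse.getVert ⌊gp G z x y⌋₊) : ℝ)
      (G.dist (r.getVert ⌊gp G x y z⌋₊) (q.reverse.getVert ⌊gp G x y z⌋₊) : ℝ))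

/-- Insize `ι(G)`: least upper bound on insizes of geodesic triangles. -/
def insize (G : SimpleGraph V) : ℝ :=
  sInf {δ : ℝ | ∀ (x y z : V) (p : G.Walk x y) (q : G.Walk y z) (r : G.Walk z x),
    IsGeodesic G p → IsGeodesic G q → IsGeodesic G r → triInsize G p q r ≤ δ}

/-- A geodesic triangle with sides `p : x → y`, `q : y → z`, `r : z → x` is `δ`-slim. -/
def TriangleSlim (G : SimpleGraph V) (δ : ℝ) {x y z : V}
    (p : G.Walk x y) (q : G.Walk y z) (r : G.Walk z x) : Prop :=
  (∀ a ∈ p.support, ∃ b, (b ∈ q.support ∨ b ∈ r.support) ∧ (G.dist a b : ℝ) ≤ δ) ∧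
  (∀ a ∈ q.support, ∃ b, (b ∈ r.support ∨ b ∈ p.support) ∧ (G.dist a b : ℝ) ≤ δ) ∧
  (∀ a ∈ r.support, ∃ b, (b ∈ p.support ∨ b ∈ q.support) ∧ (G.dist a b : ℝ) ≤ δ)

/-- Slimness `ς(G)`: least `δ` such that every geodesic triangle is `δ`-slim. -/
def slimness (G : SimpleGraph V) : ℝ :=
  sInf {δ : ℝ | ∀ (x y z : V) (p : G.Walk x y) (q : G.Walk y z) (r : G.Walk z x),
    IsGeodesic G p → IsGeodesic G q → IsGeodesic G r → TriangleSlim G δ p q r}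

/-- The metric interval `I(u,v)`. -/
def interval (G : SimpleGraph V) (u v : V) : Set V :=
  {x | G.dist u x + G.dist x v = G.dist u v}

/-- Interval thinness `κ(G)`. -/
def intervalThinness (G : SimpleGraph V) : ℝ :=
  sInf {κ : ℝ | ∀ x y a b : V, a ∈ interval G x y → b ∈ interval G x y →
    G.dist x a = G.dist x b → (G.dist a b : ℝ) ≤ κ}

/-- A BFS-tree of `G` rooted at `w`: a spanning tree (encoded by its parent function)
in which the path from `w` to any vertex is a shortest path of `G`. -/
structure BFSTree (G : SimpleGraph V) (w : V) where
  parent : V → V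
  parent_root : parent w = w
  adj_parent : ∀ x, x ≠ w → G.Adj (parent x) x
  dist_parent : ∀ x, x ≠ w → G.dist w (parent x) + 1 = G.dist w x

/-- The vertex of the tree path `[w,x]_T` at distance `r` from the root `w`
(for `r ≤ d(w,x)`). -/
def treeVert (G : SimpleGraph V) {w : V} (T : BFSTree G w) (x : V) (r : ℕ) : V :=
  T.parent^[G.dist w x - r] x

/-- `v` lies on the tree path `[w,x]_T`. -/
def onRootPath (G : SimpleGraph V) {w : V} (T : BFSTree G w) (x v : V) : Prop :=
  ∃ i ≤ G.dist w x, v = T.parent^[i] x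

/-- The rooted insize `ρ_{w,T}(G) = max {d(x_y, y_x) : x, y ∈ V}`, where `x_y`, `y_x` are
the vertices of `[w,x]_T`, `[w,y]_T` at distance `⌊(x|y)_w⌋` from `w`. -/
def rootedInsize (G : SimpleGraph V) {w : V} (T : BFSTree G w) : ℝ :=
  sSup {ρ : ℝ | ∃ x y : V,
    ρ = (G.dist (treeVert G T x ⌊gp G x y w⌋₊) (treeVert G T y ⌊gp G x y w⌋₊) : ℝ)}

/-- The rooted thinness `μ_{w,T}(G)`. -/
def rootedThinness (G : SimpleGraph V) {w : V} (T : BFSTree G w) : ℝ :=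
  sSup {μ : ℝ | ∃ x y x' y' : V, onRootPath G T x x' ∧ onRootPath G T y y' ∧
    G.dist w x' = G.dist w y' ∧ (G.dist w x' : ℝ) ≤ gp G x y w ∧
    μ = (G.dist x' y' : ℝ)}

section Geodesic

variable {G : SimpleGraph V} {u v w x y z a b : V}

lemma IsGeodesic.reverse {p : G.Walk u v} (hp : IsGeodesic G p) : IsGeodesic G p.reverse := by
  rw [IsGeodesic, Walk.length_reverse, hp, dist_comm]

lemma isGeodesic_nil : IsGeodesic G (Walk.nil : G.Walk u u) := by
  simp [IsGeodesic]

lemma dist_getVert_le (p : G.Walk u v) (i : ℕ) : G.dist u (p.getVert i) ≤ i :=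
  (dist_le (p.take i)).trans (by simp [Walk.take_length])

lemma dist_getVert_le_length_sub (p : G.Walk u v) (i : ℕ) :
    G.dist (p.getVert i) v ≤ p.length - i :=
  (dist_le (p.drop i)).trans (by simp [Walk.drop_length])

lemma IsGeodesic.dist_getVert (hG : G.Connected) {p : G.Walk u v} (hp : IsGeodesic G p) {i : ℕ}
    (hi : i ≤ p.length) : G.dist u (p.getVert i) = i := by
  have h₁ := dist_getVert_le p i
  have h₂ := dist_getVert_le_length_sub p i
  have h₃ := hG.dist_triangle (u := u) (v := p.getVert i) (w := v)
  rw [IsGeodesic] at hp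
  omega

lemma IsGeodesic.take (hG : G.Connected) {p : G.Walk u v} (hp : IsGeodesic G p) {i : ℕ}
    (hi : i ≤ p.length) : IsGeodesic G (p.take i) := by
  rw [IsGeodesic, Walk.take_length, hp.dist_getVert hG hi, min_eq_left hi]

lemma IsGeodesic.eq_getVert_of_mem (hG : G.Connected) {p : G.Walk u v} (hp : IsGeodesic G p)
    (ha : a ∈ p.support) : a = p.getVert (G.dist u a) := by
  obtain ⟨i, rfl, hi⟩ := Walk.mem_support_iff_exists_getVert.1 ha
  rw [hp.dist_getVert hG hi]

lemma IsGeodesic.dist_add_dist_of_mem (hG : G.Connected) {p : G.Walk u v} (hp : IsGeodesic G p)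
    (ha : a ∈ p.support) : G.dist u a + G.dist a v = G.dist u v := by
  obtain ⟨i, rfl, hi⟩ := Walk.mem_support_iff_exists_getVert.1 ha
  have h₁ := hp.dist_getVert hG hi
  have h₂ := dist_getVert_le_length_sub p i
  have h₃ := hG.dist_triangle (u := u) (v := p.getVert i) (w := v)
  rw [IsGeodesic] at hp
  omega

lemma IsGeodesic.dist_of_mem_of_le (hG : G.Connected) {p : G.Walk u v} (hp : IsGeodesic G p)
    (ha : a ∈ p.support) (hb : b ∈ p.support) (hab : G.dist u a ≤ G.dist u b) :
    G.dist u a + G.dist a b = G.dist u b := by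
  have hb' := hp.eq_getVert_of_mem hG hb
  obtain ⟨j, rfl, hj⟩ := Walk.mem_support_iff_exists_getVert.1 hb
  have ha' := hp.eq_getVert_of_mem hG ha
  obtain ⟨i, rfl, hi⟩ := Walk.mem_support_iff_exists_getVert.1 ha
  rw [hp.dist_getVert hG hi, hp.dist_getVert hG hj] at hab
  refine (hp.take hG hj).dist_add_dist_of_mem hG ?_
  refine Walk.mem_support_iff_exists_getVert.2 ⟨i, ?_, ?_⟩
  · rw [Walk.take_getVert, min_eq_right hab]
  · rw [Walk.take_length]
    exact le_min hab hi

lemma natCast_le_gp_iff {k : ℕ} :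
    (k : ℝ) ≤ gp G y z w ↔ 2 * k + G.dist y z ≤ G.dist y w + G.dist z w := by
  rw [gp, ← Nat.cast_le (α := ℝ)]
  push_cast
  constructor <;> intro h <;> linarith

lemma natFloor_gp_eq {k : ℕ} (h₁ : 2 * k + G.dist y z ≤ G.dist y w + G.dist z w)
    (h₂ : G.dist y w + G.dist z w ≤ 2 * k + G.dist y z + 1) : ⌊gp G y z w⌋₊ = k := by
  have h₁' := natCast_le_gp_iff.2 h₁
  have h₂' : ¬ ((k + 1 : ℕ) : ℝ) ≤ gp G y z w := by
    rw [natCast_le_gp_iff]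
    omega
  push_cast at h₂'
  rw [Nat.floor_eq_iff ((Nat.cast_nonneg k).trans h₁')]
  exact ⟨h₁', not_le.1 h₂'⟩

lemma gp_nonneg (hG : G.Connected) (y z w : V) : 0 ≤ gp G y z w := by
  have h := hG.dist_triangle (u := y) (v := w) (w := z)
  rw [dist_comm (u := w)] at h
  simpa using natCast_le_gp_iff (k := 0).2 (by simpa using h)

lemma ThinCorner.dist_getVert_floor_le (hG : G.Connected) {δ : ℝ} {p : G.Walk v u}
    {q : G.Walk v w} (hp : IsGeodesic G p) (hq : IsGeodesic G q) (h : ThinCorner G δ p q) :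
    (G.dist (p.getVert ⌊gp G u w v⌋₊) (q.getVert ⌊gp G u w v⌋₊) : ℝ) ≤ δ := by
  have hk := Nat.floor_le (gp_nonneg hG u w v)
  generalize ⌊gp G u w v⌋₊ = k at hk ⊢
  have hk' := natCast_le_gp_iff.1 hk
  have h₁ := hG.dist_triangle (u := u) (v := w) (w := v)
  have h₂ := hG.dist_triangle (u := w) (v := u) (w := v)
  rw [dist_comm (u := w) (v := u)] at h₂
  have hkp : k ≤ p.length := by rw [hp, dist_comm]; omega
  have hkq : k ≤ q.length := by rw [hq, dist_comm]; omega
  refine h _ (p.getVert_mem_support k) _ (q.getVert_mem_support k) ?_ ?_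
  · rw [hp.dist_getVert hG hkp, hq.dist_getVert hG hkq]
  · rwa [hp.dist_getVert hG hkp]

lemma exists_getVert_natFloor_gp_eq (hG : G.Connected) {q : G.Walk v w} (hq : IsGeodesic G q)
    {k : ℕ} (hk : (k : ℝ) ≤ gp G u w v) :
    ∃ t ≤ q.length, k ≤ t ∧ ⌊gp G u (q.getVert t) v⌋₊ = k := by
  classical
  have hex : ∃ t, t ≤ q.length ∧ 2 * k + G.dist u (q.getVert t) ≤ G.dist u v + t := by
    refine ⟨q.length, le_rfl, ?_⟩
    have := natCast_le_gp_iff.1 hk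
    rw [dist_comm (u := w)] at this
    rw [Walk.getVert_length, hq]
    exact this
  obtain ⟨t, ⟨ht, hkt⟩, hmin⟩ :
      ∃ t, (t ≤ q.length ∧ 2 * k + G.dist u (q.getVert t) ≤ G.dist u v + t) ∧
        ∀ s < t, ¬ (s ≤ q.length ∧ 2 * k + G.dist u (q.getVert s) ≤ G.dist u v + s) :=
    ⟨Nat.find hex, Nat.find_spec hex, fun s hs => Nat.find_min hex hs⟩
  have hvt : G.dist (q.getVert t) v = t := by rw [dist_comm, hq.dist_getVert hG ht]
  have huv := hG.dist_triangle (u := u) (v := q.getVert t) (w := v)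
  refine ⟨t, ht, by omega, natFloor_gp_eq (by omega) ?_⟩
  cases t with
  | zero =>
    simp only [Walk.getVert_zero] at hvt hkt ⊢
    omega
  | succ s =>
    have hs := hmin s (Nat.lt_succ_self s)
    have hadj := q.adj_getVert_succ (i := s) (by omega)
    have hstep := hG.dist_triangle (u := u) (v := q.getVert (s + 1)) (w := q.getVert s)
    rw [dist_eq_one_iff_adj.2 hadj.symm] at hstep
    rw [hvt]
    omega

lemma thinCorner_of_forall_dist_getVert_floor_le (hG : G.Connected) {δ : ℝ}
    (h : ∀ (x y z : V) (p : G.Walk x y) (q : G.Walk x z), IsGeodesic G p → IsGeodesic G q →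
      (G.dist (p.getVert ⌊gp G y z x⌋₊) (q.getVert ⌊gp G y z x⌋₊) : ℝ) ≤ δ)
    {p : G.Walk v u} {q : G.Walk v w} (hp : IsGeodesic G p) (hq : IsGeodesic G q) :
    ThinCorner G δ p q := by
  intro a ha b hb hab hle
  obtain ⟨t, ht, hkt, hfloor⟩ := exists_getVert_natFloor_gp_eq hG hq hle
  have := h _ _ _ p (q.take t) hp (hq.take hG ht)
  rw [hfloor, Walk.take_getVert, min_eq_right hkt, ← hp.eq_getVert_of_mem hG ha, hab,
    ← hq.eq_getVert_of_mem hG hb] at this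
  exact this

lemma exists_dist_le_of_thinCorner (hG : G.Connected) {δ : ℝ} {p : G.Walk x y} {q : G.Walk y z}
    {r : G.Walk z x} (hp : IsGeodesic G p) (hq : IsGeodesic G q) (hr : IsGeodesic G r)
    (hx : ThinCorner G δ p r.reverse) (hy : ThinCorner G δ q p.reverse) (ha : a ∈ p.support) :
    ∃ b, (b ∈ q.support ∨ b ∈ r.support) ∧ (G.dist a b : ℝ) ≤ δ := by
  have hsum := hp.dist_add_dist_of_mem hG ha
  have htri := hG.dist_triangle (u := x) (v := z) (w := y)
  have hxy := G.dist_comm (u := x) (v := y)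
  have hxz := G.dist_comm (u := x) (v := z)
  have hyz := G.dist_comm (u := y) (v := z)
  have hay := G.dist_comm (u := a) (v := y)
  by_cases hcase : 2 * G.dist x a + G.dist y z ≤ G.dist y x + G.dist z x
  · have hle : G.dist x a ≤ r.reverse.length := by rw [hr.reverse]; omega
    refine ⟨r.reverse.getVert (G.dist x a), .inr ?_, ?_⟩
    · simpa using r.reverse.getVert_mem_support (G.dist x a)
    · exact hx a ha _ (Walk.getVert_mem_support _ _) (hr.reverse.dist_getVert hG hle).symm
        (natCast_le_gp_iff.2 hcase)
  · have hle : G.dist y a ≤ q.length := by rw [hq]; omega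
    refine ⟨q.getVert (G.dist y a), .inl (q.getVert_mem_support _), ?_⟩
    rw [SimpleGraph.dist_comm]
    refine hy _ (q.getVert_mem_support _) a (by simpa using ha) (hq.dist_getVert hG hle) ?_
    rw [hq.dist_getVert hG hle, natCast_le_gp_iff]
    omega

lemma thinCorner_of_exists_dist_le (hG : G.Connected) {δ : ℝ} {p : G.Walk v u} {q : G.Walk v w}
    {s : G.Walk u w} (hp : IsGeodesic G p) (hq : IsGeodesic G q) (hs : IsGeodesic G s)
    (hpδ : ∀ a ∈ p.support, ∃ b, (b ∈ q.support ∨ b ∈ s.support) ∧ (G.dist a b : ℝ) ≤ δ)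
    (hqδ : ∀ a ∈ q.support, ∃ b, (b ∈ p.support ∨ b ∈ s.support) ∧ (G.dist a b : ℝ) ≤ δ) :
    ThinCorner G (4 * δ) p q := by
  intro a ha b hb hab hle
  obtain ⟨a', ha', haδ⟩ := hpδ a ha
  obtain ⟨b', hb', hbδ⟩ := hqδ b hb
  have triangle (c d e : V) : (G.dist c e : ℝ) ≤ G.dist c d + G.dist d e :=
    mod_cast hG.dist_triangle
  have comm (c d : V) : (G.dist c d : ℝ) = G.dist d c := by rw [dist_comm]
  have hab' : (G.dist v a : ℝ) = G.dist v b := mod_cast hab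
  have hδ : 0 ≤ δ := (Nat.cast_nonneg _).trans haδ
  have hpa : (G.dist v a : ℝ) + G.dist a u = G.dist v u := mod_cast hp.dist_add_dist_of_mem hG ha
  have hqb : (G.dist v b : ℝ) + G.dist b w = G.dist v w := mod_cast hq.dist_add_dist_of_mem hG hb
  -- Two points at equal distance from `v`, one of them `δ`-close to the other's side.
  have key {c d c' t : V} {o : G.Walk v t} (ho : IsGeodesic G o) (hd : d ∈ o.support)
      (hc' : c' ∈ o.support) (hcd : (G.dist v c : ℝ) = G.dist v d)
      (hc : (G.dist c c' : ℝ) ≤ δ) : (G.dist c d : ℝ) ≤ 4 * δ := by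
    have h₁ := triangle c c' d
    have h₂ := triangle v c c'
    have h₃ := triangle v c' c
    have h₄ := comm c' c
    have h₅ := comm c' d
    rcases le_total (G.dist v d) (G.dist v c') with h | h
    · have h₆ : (G.dist v d : ℝ) + G.dist d c' = G.dist v c' :=
        mod_cast ho.dist_of_mem_of_le hG hd hc' h
      linarith
    · have h₆ : (G.dist v c' : ℝ) + G.dist c' d = G.dist v d :=
        mod_cast ho.dist_of_mem_of_le hG hc' hd h
      linarith
  rcases ha' with ha' | ha'
  · exact key hq hb ha' hab' haδ
  rcases hb' with hb' | hb'
  · rw [comm]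
    exact key hp ha hb' hab'.symm hbδ
  have hsa : (G.dist u a' : ℝ) + G.dist a' w = G.dist u w :=
    mod_cast hs.dist_add_dist_of_mem hG ha'
  have hsb : (G.dist u b' : ℝ) + G.dist b' w = G.dist u w :=
    mod_cast hs.dist_add_dist_of_mem hG hb'
  rw [gp] at hle
  have h₁ := triangle v a a'
  have h₂ := triangle v a' u
  have h₃ := triangle v a' w
  have h₄ := triangle v b b'
  have h₅ := triangle v b' u
  have h₆ := triangle v b' w
  have h₇ := triangle a a' b
  have h₈ := triangle a' b' b
  have h₉ := comm b' b
  have h₁₀ := comm a' u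
  have h₁₁ := comm b' u
  have h₁₂ := comm u v
  have h₁₃ := comm w v
  have h₁₄ := comm a' b'
  rcases le_total (G.dist u a') (G.dist u b') with h | h
  · have h₁₅ : (G.dist u a' : ℝ) + G.dist a' b' = G.dist u b' :=
      mod_cast hs.dist_of_mem_of_le hG ha' hb' h
    linarith
  · have h₁₅ : (G.dist u b' : ℝ) + G.dist b' a' = G.dist u a' :=
      mod_cast hs.dist_of_mem_of_le hG hb' ha' h
    linarith

lemma triInsize_le_of_triangleThin (hG : G.Connected) {δ : ℝ} {p : G.Walk x y} {q : G.Walk y z}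
    {r : G.Walk z x} (hp : IsGeodesic G p) (hq : IsGeodesic G q) (hr : IsGeodesic G r)
    (h : TriangleThin G δ p q r) : triInsize G p q r ≤ δ :=
  max_le (h.1.dist_getVert_floor_le hG hp hr.reverse)
    (max_le (h.2.1.dist_getVert_floor_le hG hq hp.reverse)
      (h.2.2.dist_getVert_floor_le hG hr hq.reverse))

lemma triangleThin_of_forall_triInsize_le (hG : G.Connected) {δ : ℝ}
    (h : ∀ (x y z : V) (p : G.Walk x y) (q : G.Walk y z) (r : G.Walk z x),
      IsGeodesic G p → IsGeodesic G q → IsGeodesic G r → triInsize G p q r ≤ δ)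
    {p : G.Walk x y} {q : G.Walk y z} {r : G.Walk z x} (hp : IsGeodesic G p)
    (hq : IsGeodesic G q) (hr : IsGeodesic G r) : TriangleThin G δ p q r := by
  have hcorner (x y z : V) (p : G.Walk x y) (q : G.Walk x z) (hp : IsGeodesic G p)
      (hq : IsGeodesic G q) :
      (G.dist (p.getVert ⌊gp G y z x⌋₊) (q.getVert ⌊gp G y z x⌋₊) : ℝ) ≤ δ := by
    obtain ⟨s, hs⟩ := hG.exists_walk_length_eq_dist y z
    have := (le_max_left _ _).trans (h x y z p s q.reverse hp hs hq.reverse)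
    rwa [Walk.reverse_reverse] at this
  exact ⟨thinCorner_of_forall_dist_getVert_floor_le hG hcorner hp hr.reverse,
    thinCorner_of_forall_dist_getVert_floor_le hG hcorner hq hp.reverse,
    thinCorner_of_forall_dist_getVert_floor_le hG hcorner hr hq.reverse⟩

lemma triangleSlim_of_triangleThin (hG : G.Connected) {δ : ℝ} {p : G.Walk x y} {q : G.Walk y z}
    {r : G.Walk z x} (hp : IsGeodesic G p) (hq : IsGeodesic G q) (hr : IsGeodesic G r)
    (h : TriangleThin G δ p q r) : TriangleSlim G δ p q r :=
  ⟨fun _ => exists_dist_le_of_thinCorner hG hp hq hr h.1 h.2.1,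
    fun _ => exists_dist_le_of_thinCorner hG hq hr hp h.2.1 h.2.2,
    fun _ => exists_dist_le_of_thinCorner hG hr hp hq h.2.2 h.1⟩

lemma triangleThin_of_triangleSlim (hG : G.Connected) {δ : ℝ} {p : G.Walk x y} {q : G.Walk y z}
    {r : G.Walk z x} (hp : IsGeodesic G p) (hq : IsGeodesic G q) (hr : IsGeodesic G r)
    (h : TriangleSlim G δ p q r) : TriangleThin G (4 * δ) p q r := by
  obtain ⟨h₁, h₂, h₃⟩ := h
  refine ⟨thinCorner_of_exists_dist_le hG hp hr.reverse hq ?_ ?_,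
    thinCorner_of_exists_dist_le hG hq hp.reverse hr ?_ ?_,
    thinCorner_of_exists_dist_le hG hr hq.reverse hp ?_ ?_⟩ <;>
    simp only [Walk.support_reverse, List.mem_reverse]
  · simpa only [or_comm] using h₁
  · exact h₃
  · simpa only [or_comm] using h₂
  · exact h₁
  · simpa only [or_comm] using h₃
  · exact h₂

end Geodesic

lemma insize_eq_thinness {G : SimpleGraph V} (hG : G.Connected) : insize G = thinness G :=
  congrArg sInf <| Set.ext fun _ =>
    ⟨fun h _ _ _ _ _ _ => triangleThin_of_forall_triInsize_le hG h,
      fun h x y z p q r hp hq hr =>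
        triInsize_le_of_triangleThin hG hp hq hr (h x y z p q r hp hq hr)⟩

/-- For every finite connected graph `G`, `ς(G) ≤ ι(G) = τ(G) ≤ 4·ς(G)`. -/
theorem slimness_le_insize_eq_thinness_le_four_slimness
    {V : Type*} [Fintype V] (G : SimpleGraph V) (hG : G.Connected) :
    slimness G ≤ insize G ∧ insize G = thinness G ∧ thinness G ≤ 4 * slimness G := by
  obtain ⟨v⟩ := hG.nonempty
  have hne : {δ : ℝ | ∀ (x y z : V) (p : G.Walk x y) (q : G.Walk y z) (r : G.Walk z x),
      IsGeodesic G p → IsGeodesic G q → IsGeodesic G r → TriangleThin G δ p q r}.Nonempty := by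
    obtain ⟨N, hN⟩ :=
      (Set.finite_range fun c : V × V => (G.dist c.1 c.2 : ℝ)).bddAbove
    have hN' (a b : V) : (G.dist a b : ℝ) ≤ N := hN ⟨(a, b), rfl⟩
    exact ⟨N, fun x y z p q r _ _ _ => ⟨fun a _ b _ _ _ => hN' a b, fun a _ b _ _ _ => hN' a b,
      fun a _ b _ _ _ => hN' a b⟩⟩
  have hslim : ∀ δ ∈ {δ : ℝ | ∀ (x y z : V) (p : G.Walk x y) (q : G.Walk y z) (r : G.Walk z x),
      IsGeodesic G p → IsGeodesic G q → IsGeodesic G r → TriangleSlim G δ p q r}, 0 ≤ δ := by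
    intro δ h
    obtain ⟨b, -, hb⟩ := (h v v v .nil .nil .nil isGeodesic_nil isGeodesic_nil
      isGeodesic_nil).1 v (by simp)
    exact (Nat.cast_nonneg _).trans hb
  have hthin : ∀ δ ∈ {δ : ℝ | ∀ (x y z : V) (p : G.Walk x y) (q : G.Walk y z) (r : G.Walk z x),
      IsGeodesic G p → IsGeodesic G q → IsGeodesic G r → TriangleThin G δ p q r},
      ∀ (x y z : V) (p : G.Walk x y) (q : G.Walk y z) (r : G.Walk z x),
      IsGeodesic G p → IsGeodesic G q → IsGeodesic G r → TriangleSlim G δ p q r :=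
    fun δ h x y z p q r hp hq hr =>
      triangleSlim_of_triangleThin hG hp hq hr (h x y z p q r hp hq hr)
  refine ⟨?_, insize_eq_thinness hG, ?_⟩
  · rw [insize_eq_thinness hG]
    exact csInf_le_csInf ⟨0, hslim⟩ hne hthin
  · have : thinness G / 4 ≤ slimness G := by
      refine le_csInf (hne.mono hthin) fun δ h => ?_
      have : thinness G ≤ 4 * δ :=
        csInf_le ⟨0, fun ε hε => hslim ε (hthin ε hε)⟩ fun x y z p q r hp hq hr =>
          triangleThin_of_triangleSlim hG hp hq hr (h x y z p q r hp hq hr)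
      linarith
    linarith

end HypPaper
end
end

section
/- For every finite connected graph G, κ(G) ≤ min{τ(G), 2·δ(G), 2·ς(G)}. -/
open SimpleGraph

noncomputable section

namespace HypPaper

variable {V : Type*}

/-- In a connected graph, every vertex of the interval `I(x,y)` lies on a geodesic. -/
lemma exists_isGeodesic_of_mem_interval {V : Type*} {G : SimpleGraph V} (hG : G.Connected)
    {x y a : V} (ha : a ∈ interval G x y) :
    ∃ p : G.Walk x y, IsGeodesic G p ∧ a ∈ p.support := by
  obtain ⟨p, hp⟩ := hG.exists_walk_length_eq_dist x a
  obtain ⟨q, hq⟩ := hG.exists_walk_length_eq_dist a y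
  refine ⟨p.append q, ?_, ?_⟩
  · have h : G.dist x a + G.dist a y = G.dist x y := ha
    rw [IsGeodesic, Walk.length_append, hp, hq, h]
  · simp [Walk.mem_support_append_iff]

/-- Every vertex of a geodesic lies in the interval between its endpoints. -/
lemma IsGeodesic.mem_interval {V : Type*} {G : SimpleGraph V} (hG : G.Connected)
    {x y a : V} {p : G.Walk x y} (hp : IsGeodesic G p) (ha : a ∈ p.support) :
    a ∈ interval G x y := by
  classical
  have h₁ := dist_le (p.takeUntil a ha)
  have h₂ := dist_le (p.dropUntil a ha)
  have h₃ : (p.takeUntil a ha).length + (p.dropUntil a ha).length = p.length := by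
    rw [← Walk.length_append, Walk.take_spec]
  have h₄ : G.dist x y ≤ G.dist x a + G.dist a y := hG.dist_triangle
  have h₅ : p.length = G.dist x y := hp
  change G.dist x a + G.dist a y = G.dist x y
  omega

lemma exists_dist_le {V : Type*} [Finite V] (G : SimpleGraph V) :
    ∃ N : ℝ, ∀ a b : V, (G.dist a b : ℝ) ≤ N := by
  obtain ⟨N, hN⟩ := (Set.finite_range fun e : V × V => (G.dist e.1 e.2 : ℝ)).bddAbove
  exact ⟨N, fun a b => hN ⟨(a, b), rfl⟩⟩

lemma intervalThinness_le {V : Type*} [Nonempty V] {G : SimpleGraph V} {κ : ℝ}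
    (h : ∀ x y a b : V, a ∈ interval G x y → b ∈ interval G x y →
      G.dist x a = G.dist x b → (G.dist a b : ℝ) ≤ κ) :
    intervalThinness G ≤ κ := by
  refine csInf_le ⟨0, fun k hk => ?_⟩ h
  obtain ⟨v⟩ := ‹Nonempty V›
  simpa using hk v v v v (by simp [interval]) (by simp [interval]) rfl

lemma intervalThinness_le_thinness {V : Type*} [Finite V] {G : SimpleGraph V}
    (hG : G.Connected) : intervalThinness G ≤ thinness G := by
  have := hG.nonempty
  obtain ⟨N, hN⟩ := exists_dist_le G
  refine le_csInf ⟨N, fun x y z p q r _ _ _ => ?_⟩ fun δ hδ => intervalThinness_le ?_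
  · exact ⟨fun a _ b _ _ _ => hN a b, fun a _ b _ _ _ => hN a b, fun a _ b _ _ _ => hN a b⟩
  intro x y a b ha hb hab
  obtain ⟨p, hp, hap⟩ := exists_isGeodesic_of_mem_interval hG ha
  obtain ⟨r, hr, hbr⟩ := exists_isGeodesic_of_mem_interval hG hb
  have hr' : IsGeodesic G r.reverse := by
    rw [IsGeodesic, Walk.length_reverse, hr, dist_comm]
  refine (hδ x y y p .nil r.reverse hp (by simp [IsGeodesic]) hr').1 a hap b (by simpa) hab ?_
  have h : G.dist x a + G.dist a y = G.dist x y := ha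
  have h' : (G.dist x a : ℝ) ≤ G.dist x y := by exact_mod_cast (by omega)
  simpa [gp, G.dist_comm (u := y)] using h'

lemma IsDeltaHyp.dist_le_of_mem_interval {V : Type*} {G : SimpleGraph V} {δ : ℝ}
    (h : IsDeltaHyp G δ) {x y a b : V} (ha : a ∈ interval G x y) (hb : b ∈ interval G x y)
    (hab : G.dist x a = G.dist x b) : (G.dist a b : ℝ) ≤ 2 * δ := by
  have ha' : (G.dist x a : ℝ) + G.dist a y = G.dist x y := by exact_mod_cast ha
  have hb' : (G.dist x b : ℝ) + G.dist b y = G.dist x y := by exact_mod_cast hb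
  have hab' : (G.dist x a : ℝ) = G.dist x b := by exact_mod_cast hab
  have h₁ := h x a b y
  simp only [gp, G.dist_comm (v := x)] at h₁
  rcases min_choice (((G.dist x a : ℝ) + G.dist x y - G.dist a y) / 2)
    (((G.dist x b : ℝ) + G.dist x y - G.dist b y) / 2) with h₂ | h₂ <;>
  · rw [h₂] at h₁
    linarith

lemma intervalThinness_le_two_mul_hyperbolicity {V : Type*} [Finite V] {G : SimpleGraph V}
    (hG : G.Connected) : intervalThinness G ≤ 2 * hyperbolicity G := by
  obtain ⟨v⟩ := hG.nonempty
  have : Nonempty V := ⟨v⟩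
  obtain ⟨N, hN⟩ := exists_dist_le G
  have hN₀ : 0 ≤ N := (Nat.cast_nonneg _).trans (hN v v)
  suffices intervalThinness G / 2 ≤ hyperbolicity G by linarith
  refine le_csInf ⟨2 * N, by positivity, fun w x y z => ?_⟩ fun δ hδ => ?_
  · have h₁ := min_le_left (gp G x z w) (gp G y z w)
    have h₂ : gp G x z w ≤ N := by
      have : (0 : ℝ) ≤ G.dist x z := Nat.cast_nonneg _
      linarith [hN x w, hN z w, gp.eq_1 G x z w]
    have h₃ : -N ≤ gp G x y w := by
      have h₄ : (0 : ℝ) ≤ G.dist x w := Nat.cast_nonneg _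
      have h₅ : (0 : ℝ) ≤ G.dist y w := Nat.cast_nonneg _
      linarith [hN x y, gp.eq_1 G x y w]
    linarith
  · have := intervalThinness_le fun x y a b ha hb hab =>
      hδ.2.dist_le_of_mem_interval (x := x) (y := y) (a := a) (b := b) ha hb hab
    linarith

lemma intervalThinness_le_two_mul_slimness {V : Type*} [Finite V] {G : SimpleGraph V}
    (hG : G.Connected) : intervalThinness G ≤ 2 * slimness G := by
  have := hG.nonempty
  obtain ⟨N, hN⟩ := exists_dist_le G
  suffices intervalThinness G / 2 ≤ slimness G by linarith
  refine le_csInf ⟨N, fun x y z p q r _ _ _ => ?_⟩ fun δ hδ => ?_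
  · exact ⟨fun a _ => ⟨y, .inl q.start_mem_support, hN a y⟩,
      fun a _ => ⟨z, .inl r.start_mem_support, hN a z⟩,
      fun a _ => ⟨x, .inl p.start_mem_support, hN a x⟩⟩
  suffices intervalThinness G ≤ 2 * δ by linarith
  refine intervalThinness_le fun x y a b ha hb hab => ?_
  obtain ⟨p, hp, hap⟩ := exists_isGeodesic_of_mem_interval hG ha
  obtain ⟨q, hq⟩ := hG.exists_walk_length_eq_dist y b
  obtain ⟨r, hr⟩ := hG.exists_walk_length_eq_dist b x
  obtain ⟨c, hc, hac⟩ := (hδ x y b p q r hp hq hr).1 a hap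
  have ha' : G.dist x a + G.dist a y = G.dist x y := ha
  have hb' : G.dist x b + G.dist b y = G.dist x y := hb
  have hcb : G.dist c b ≤ G.dist a c := by
    rcases hc with hc | hc
    · have h₁ : G.dist y c + G.dist c b = G.dist y b := IsGeodesic.mem_interval hG hq hc
      have h₂ : G.dist a y ≤ G.dist a c + G.dist c y := hG.dist_triangle
      rw [G.dist_comm (u := y), G.dist_comm (u := y)] at h₁
      omega
    · have h₁ : G.dist b c + G.dist c x = G.dist b x := IsGeodesic.mem_interval hG hr hc
      have h₂ : G.dist x a ≤ G.dist x c + G.dist c a := hG.dist_triangle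
      rw [G.dist_comm (u := b) (v := c), G.dist_comm (v := x), G.dist_comm (v := x)] at h₁
      rw [G.dist_comm (u := c)] at h₂
      omega
  have h : G.dist a b ≤ G.dist a c + G.dist c b := hG.dist_triangle
  have h' : (G.dist a b : ℝ) ≤ 2 * G.dist a c := by exact_mod_cast (by omega)
  linarith

/-- For every finite connected graph `G`, `κ(G) ≤ min{τ(G), 2·δ(G), 2·ς(G)}`. -/
theorem intervalThinness_le_min
    {V : Type*} [Fintype V] (G : SimpleGraph V) (hG : G.Connected) :
    intervalThinness G ≤
      min (thinness G) (min (2 * hyperbolicity G) (2 * slimness G)) := by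
  exact le_min (intervalThinness_le_thinness hG)
    (le_min (intervalThinness_le_two_mul_hyperbolicity hG)
      (intervalThinness_le_two_mul_slimness hG))

end HypPaper
end
end

section
/- Let G be a finite connected graph, w a vertex of G, T a BFS-tree of G rooted at w, and ρ = ρ_{w,T}(G). Then for all vertices x,y,z of G, d(x,z) + d(y,w) ≤ max{d(x,y) + d(z,w), d(y,z) + d(x,w)} + 2ρ + 1; equivalently, the pointed hyperbolicity satisfies δ_w(G) ≤ ρ_{w,T}(G) + 1/2. -/
open SimpleGraph

noncomputable section

namespace HypPaper

variable {V : Type*}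

theorem dist_iterate_parent_le {G : SimpleGraph V} (hG : G.Connected) {w : V}
    (T : BFSTree G w) (x : V) (n : ℕ) : G.dist x (T.parent^[n] x) ≤ n := by
  induction n with
  | zero => simp
  | succ n ih =>
    rw [Function.iterate_succ_apply']
    have hstep : G.dist (T.parent^[n] x) (T.parent (T.parent^[n] x)) ≤ 1 := by
      by_cases h : T.parent^[n] x = w
      · simp [h, T.parent_root]
      · exact (dist_eq_one_iff_adj.mpr (T.adj_parent _ h).symm).le
    have := hG.dist_triangle (u := x) (v := T.parent^[n] x) (w := T.parent (T.parent^[n] x))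
    lia

theorem dist_treeVert_le {G : SimpleGraph V} (hG : G.Connected) {w : V}
    (T : BFSTree G w) (x : V) (r : ℕ) : G.dist x (treeVert G T x r) ≤ G.dist w x - r :=
  dist_iterate_parent_le hG T x _

theorem dist_treeVert_treeVert_le {G : SimpleGraph V} (hG : G.Connected) {w : V}
    (T : BFSTree G w) (x : V) {r s : ℕ} (hrs : r ≤ s) (hs : s ≤ G.dist w x) :
    G.dist (treeVert G T x s) (treeVert G T x r) ≤ s - r := by
  have h : treeVert G T x r = T.parent^[s - r] (treeVert G T x s) := by
    rw [treeVert, treeVert, ← Function.iterate_add_apply]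
    congr 1
    lia
  rw [h]
  exact dist_iterate_parent_le hG T _ _

theorem gp_comm (G : SimpleGraph V) (x y w : V) : gp G x y w = gp G y x w := by
  rw [gp, gp, G.dist_comm (u := x) (v := y)]
  ring

theorem dist_treeVert_le_rootedInsize [Finite V] (G : SimpleGraph V) {w : V}
    (T : BFSTree G w) (x y : V) :
    (G.dist (treeVert G T x ⌊gp G x y w⌋₊) (treeVert G T y ⌊gp G x y w⌋₊) : ℝ) ≤
      rootedInsize G T := by
  refine le_csSup ?_ ⟨x, y, rfl⟩
  refine ((Set.finite_range fun p : V × V =>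
    (G.dist (treeVert G T p.1 ⌊gp G p.1 p.2 w⌋₊)
      (treeVert G T p.2 ⌊gp G p.1 p.2 w⌋₊) : ℝ)).subset ?_).bddAbove
  rintro _ ⟨a, b, rfl⟩
  exact ⟨(a, b), rfl⟩

theorem floor_gp_eq {G : SimpleGraph V} (x y w : V) (hG : G.Connected) :
    ⌊gp G x y w⌋₊ = (G.dist w x + G.dist w y - G.dist x y) / 2 := by
  have h := hG.dist_triangle (u := x) (v := w) (w := y)
  rw [G.dist_comm (u := x) (v := w)] at h
  rw [gp, G.dist_comm (u := x) (v := w), G.dist_comm (u := y) (v := w), ← Nat.cast_add,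
    ← Nat.cast_sub h]
  exact_mod_cast Nat.floor_div_eq_div (K := ℝ) _ 2

theorem gp_sub_half_le_floor_gp {G : SimpleGraph V} (hG : G.Connected) (x y w : V) :
    gp G x y w - 1 / 2 ≤ ⌊gp G x y w⌋₊ := by
  have h : G.dist x w + G.dist y w ≤ 2 * ⌊gp G x y w⌋₊ + G.dist x y + 1 := by
    rw [floor_gp_eq x y w hG, G.dist_comm (u := x) (v := w), G.dist_comm (u := y) (v := w)]
    lia
  have h' : (G.dist x w + G.dist y w : ℝ) ≤ 2 * ⌊gp G x y w⌋₊ + G.dist x y + 1 := by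
    exact_mod_cast h
  conv_lhs => rw [gp]
  linarith

theorem floor_gp_le_dist {G : SimpleGraph V} (hG : G.Connected) (x y w : V) :
    ⌊gp G x y w⌋₊ ≤ G.dist w x := by
  have h := hG.dist_triangle (u := w) (v := x) (w := y)
  rw [floor_gp_eq x y w hG]
  lia

theorem gp_sub_rootedInsize_le_of_gp_le [Finite V] {G : SimpleGraph V} (hG : G.Connected) {w : V}
    (T : BFSTree G w) {x y z : V} (h : gp G x y w ≤ gp G y z w) :
    gp G x y w - (rootedInsize G T + 1 / 2) ≤ gp G x z w := by
  have hr := gp_sub_half_le_floor_gp hG x y w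
  have hxy := dist_treeVert_le_rootedInsize G T x y
  have hyz := dist_treeVert_le_rootedInsize G T y z
  have hrs : ⌊gp G x y w⌋₊ ≤ ⌊gp G y z w⌋₊ := Nat.floor_mono h
  have hrx := floor_gp_le_dist hG x y w
  have hsy := floor_gp_le_dist hG y z w
  have hsz := floor_gp_le_dist hG z y w
  rw [gp_comm] at hsz
  generalize ⌊gp G x y w⌋₊ = r at *
  generalize ⌊gp G y z w⌋₊ = s at *
  have h₁ := dist_treeVert_le hG T x r
  have h₂ := dist_treeVert_treeVert_le hG T y hrs hsy
  have h₃ := dist_treeVert_le hG T z s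
  have t₁ := hG.dist_triangle (u := x) (v := treeVert G T x r) (w := z)
  have t₂ := hG.dist_triangle (u := treeVert G T x r) (v := treeVert G T y r) (w := z)
  have t₃ := hG.dist_triangle (u := treeVert G T y r) (v := treeVert G T y s) (w := z)
  have t₄ := hG.dist_triangle (u := treeVert G T y s) (v := treeVert G T z s) (w := z)
  rw [G.dist_comm (u := treeVert G T y r) (v := treeVert G T y s)] at t₃
  rw [G.dist_comm (u := treeVert G T z s) (v := z)] at t₄
  have key : G.dist x z + 2 * r ≤ G.dist w x + G.dist w z +
      G.dist (treeVert G T x r) (treeVert G T y r) +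
      G.dist (treeVert G T y s) (treeVert G T z s) := by lia
  have key' : (G.dist x z + 2 * r : ℝ) ≤ G.dist w x + G.dist w z +
      G.dist (treeVert G T x r) (treeVert G T y r) +
      G.dist (treeVert G T y s) (treeVert G T z s) := by exact_mod_cast key
  have hxz : gp G x z w = ((G.dist w x : ℝ) + G.dist w z - G.dist x z) / 2 := by
    rw [gp, G.dist_comm (u := x) (v := w), G.dist_comm (u := z) (v := w)]
  linarith

theorem min_gp_sub_rootedInsize_le [Finite V] {G : SimpleGraph V} (hG : G.Connected) {w : V}
    (T : BFSTree G w) (x y z : V) :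
    min (gp G x y w) (gp G y z w) - (rootedInsize G T + 1 / 2) ≤ gp G x z w := by
  rcases le_total (gp G x y w) (gp G y z w) with h | h
  · rw [min_eq_left h]
    exact gp_sub_rootedInsize_le_of_gp_le hG T h
  · rw [min_eq_right h, gp_comm G y z, gp_comm G x z]
    rw [gp_comm G y z, gp_comm G x y] at h
    exact gp_sub_rootedInsize_le_of_gp_le hG T h

/-- With `ρ = ρ_{w,T}(G)`: the four-point condition with basepoint `w` holds with constant
`2ρ + 1`, i.e., `d(x,z)+d(y,w) ≤ max{d(x,y)+d(z,w), d(y,z)+d(x,w)} + 2ρ + 1` for all `x,y,z`;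
equivalently, the pointed hyperbolicity satisfies `δ_w(G) ≤ ρ_{w,T}(G) + 1/2`. -/
theorem pointedHyp_le_rootedInsize_add_half
    {V : Type*} [Fintype V] (G : SimpleGraph V) (hG : G.Connected)
    (w : V) (T : BFSTree G w) :
    (∀ x y z : V,
      (G.dist x z : ℝ) + (G.dist y w : ℝ) ≤
        max ((G.dist x y : ℝ) + (G.dist z w : ℝ)) ((G.dist y z : ℝ) + (G.dist x w : ℝ)) +
          2 * rootedInsize G T + 1) ∧
    pointedHyp G w ≤ rootedInsize G T + 1 / 2 := by
  refine ⟨fun x y z => ?_, csInf_le ⟨0, fun δ hδ => ?_⟩ fun x y z => ?_⟩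
  · have h := min_gp_sub_rootedInsize_le hG T x y z
    have hl := le_max_left ((G.dist x y : ℝ) + G.dist z w) ((G.dist y z : ℝ) + G.dist x w)
    have hr := le_max_right ((G.dist x y : ℝ) + G.dist z w) ((G.dist y z : ℝ) + G.dist x w)
    rcases min_choice (gp G x y w) (gp G y z w) with hm | hm <;>
      rw [hm] at h <;> simp only [gp] at h <;> linarith
  · simpa using hδ w w w
  · rw [gp_comm G y z]
    exact min_gp_sub_rootedInsize_le hG T x z y

end HypPaper
end
end

section
/- For every positive integer k, there exists a finite connected graph H, a vertex w of H, and a BFS-tree T of H rooted at w such that δ(H) = k and ρ_{w,T}(H) = 4k. -/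
open SimpleGraph

noncomputable section

namespace HypPaper

variable {V : Type*}

theorem dist_eq_and_connected_of_step (G : SimpleGraph V) [Nonempty V] (f : V → V → ℕ)
    (self : ∀ u, f u u = 0) (lip : ∀ u v t, G.Adj u v → f u t ≤ f v t + 1)
    (step : ∀ u v, u ≠ v → ∃ u', G.Adj u u' ∧ f u' v + 1 = f u v) :
    G.Connected ∧ ∀ u v, G.dist u v = f u v := by
  have upper : ∀ n u v, f u v = n → ∃ p : G.Walk u v, p.length = n := by
    intro n
    induction n with
    | zero =>
      intro u v h
      by_cases huv : u = v
      · subst huv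
        exact ⟨.nil, rfl⟩
      · obtain ⟨u', -, h'⟩ := step u v huv
        omega
    | succ n ih =>
      intro u v h
      have huv : u ≠ v := by
        rintro rfl
        have := self u
        omega
      obtain ⟨u', hadj, h'⟩ := step u v huv
      obtain ⟨p, hp⟩ := ih u' v (by omega)
      exact ⟨.cons hadj p, by simp [hp]⟩
  have lower : ∀ u v (p : G.Walk u v), f u v ≤ p.length := by
    intro u v p
    induction p with
    | nil => simp [self]
    | cons h p ih =>
      have := lip _ _ _ h |>.trans (Nat.add_le_add_right ih 1)
      simpa using this
  have hconn : G.Connected :=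
    ⟨fun u v => (upper _ u v rfl).elim fun p _ => ⟨p⟩⟩
  refine ⟨hconn, fun u v => le_antisymm ?_ ?_⟩
  · obtain ⟨p, hp⟩ := upper _ u v rfl
    exact hp ▸ dist_le p
  · obtain ⟨p, hp⟩ := hconn.exists_walk_length_eq_dist u v
    exact hp ▸ lower u v p

/-- The integer points of the square `[0, 2k]²` with the open upper left quarter removed. -/
def LShape (k : ℕ) : Type :=
  {p : ℤ × ℤ // p ∈ (Finset.Icc (0 : ℤ) (2 * k) ×ˢ Finset.Icc (0 : ℤ) (2 * k)).filter
    fun p => (k : ℤ) ≤ p.1 ∨ p.2 ≤ (k : ℤ)}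

namespace LShape

variable {k : ℕ}

instance : Fintype (LShape k) := Finset.fintypeCoeSort _

def mk (a b : ℤ) (h : 0 ≤ a ∧ a ≤ 2 * k ∧ 0 ≤ b ∧ b ≤ 2 * k ∧ (k ≤ a ∨ b ≤ k)) : LShape k :=
  ⟨(a, b), by simp only [Finset.mem_filter, Finset.mem_product, Finset.mem_Icc]; omega⟩

def fst (p : LShape k) : ℤ := p.1.1

def snd (p : LShape k) : ℤ := p.1.2

@[simp] theorem fst_mk (a b : ℤ) (h) : (mk a b h : LShape k).fst = a := rfl

@[simp] theorem snd_mk (a b : ℤ) (h) : (mk a b h : LShape k).snd = b := rfl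

theorem ext {p q : LShape k} (h₁ : p.fst = q.fst) (h₂ : p.snd = q.snd) : p = q :=
  Subtype.ext (Prod.ext h₁ h₂)

theorem bounds (p : LShape k) : 0 ≤ p.fst ∧ p.fst ≤ 2 * k ∧ 0 ≤ p.snd ∧ p.snd ≤ 2 * k ∧
    (k ≤ p.fst ∨ p.snd ≤ k) := by
  have := p.2
  simp only [Finset.mem_filter, Finset.mem_product, Finset.mem_Icc] at this
  simp only [fst, snd]
  omega

def root (k : ℕ) : LShape k := mk (2 * k) 0 (by omega)

instance : Nonempty (LShape k) := ⟨root k⟩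

/-- The `ℓ¹`-distance. -/
def l1 (p q : LShape k) : ℕ := (p.fst - q.fst).natAbs + (p.snd - q.snd).natAbs

/-- The subgraph of the square grid induced by the L-shape. -/
def graph (k : ℕ) : SimpleGraph (LShape k) where
  Adj p q := l1 p q = 1
  symm := ⟨fun p q h => by simp only [l1] at *; omega⟩
  loopless := ⟨fun p h => by simp [l1] at h⟩

theorem exists_step (u v : LShape k) (huv : u ≠ v) :
    ∃ u', (graph k).Adj u u' ∧ l1 u' v + 1 = l1 u v := by
  have hu := u.bounds
  have hv := v.bounds
  simp only [graph, l1]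
  by_cases h₁ : u.fst < v.fst
  · exact ⟨mk (u.fst + 1) u.snd (by omega), by simp, by simp; omega⟩
  by_cases h₂ : v.snd < u.snd
  · exact ⟨mk u.fst (u.snd - 1) (by omega), by simp, by simp; omega⟩
  by_cases h₃ : v.fst < u.fst
  · exact ⟨mk (u.fst - 1) u.snd (by omega), by simp, by simp; omega⟩
  have h₄ : u.snd ≠ v.snd := fun h => huv (ext (by omega) h)
  exact ⟨mk u.fst (u.snd + 1) (by omega), by simp, by simp; omega⟩

theorem connected_and_dist_eq :
    (graph k).Connected ∧ ∀ u v, (graph k).dist u v = l1 u v :=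
  dist_eq_and_connected_of_step _ l1 (fun u => by simp [l1])
    (fun u v t h => by simp only [graph, l1] at *; omega) exists_step

theorem dist_eq (u v : LShape k) : (graph k).dist u v = l1 u v :=
  connected_and_dist_eq.2 u v

theorem cast_dist (u v : LShape k) :
    ((graph k).dist u v : ℝ) = ((|u.fst - v.fst| + |u.snd - v.snd| : ℤ) : ℝ) := by
  rw [dist_eq, l1]
  push_cast
  simp [Nat.cast_natAbs]

/-- The four-point condition in the L-shape. -/
theorem four_point (x y z w : LShape k) :
    |x.fst - y.fst| + |x.snd - y.snd| + (|z.fst - w.fst| + |z.snd - w.snd|) ≤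
      max (|x.fst - z.fst| + |x.snd - z.snd| + (|y.fst - w.fst| + |y.snd - w.snd|))
        (|y.fst - z.fst| + |y.snd - z.snd| + (|x.fst - w.fst| + |x.snd - w.snd|)) + 2 * k := by
  obtain ⟨hx₁, hx₂, hx₃, hx₄, hx⟩ := x.bounds
  obtain ⟨hy₁, hy₂, hy₃, hy₄, hy⟩ := y.bounds
  obtain ⟨hz₁, hz₂, hz₃, hz₄, hz⟩ := z.bounds
  obtain ⟨hw₁, hw₂, hw₃, hw₄, hw⟩ := w.bounds
  generalize x.fst = x₁, x.snd = x₂, y.fst = y₁, y.snd = y₂,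
    z.fst = z₁, z.snd = z₂, w.fst = w₁, w.snd = w₂ at *
  by_contra! h
  have h₁ := (add_le_add_left (le_max_left _ _) _).trans_lt h
  have h₂ := (add_le_add_left (le_max_right _ _) _).trans_lt h
  clear h
  have a₁ := abs_le.1 (le_refl |x₁ - z₁|)
  have a₂ := abs_le.1 (le_refl |x₂ - z₂|)
  have a₃ := abs_le.1 (le_refl |y₁ - w₁|)
  have a₄ := abs_le.1 (le_refl |y₂ - w₂|)
  have a₅ := abs_le.1 (le_refl |y₁ - z₁|)
  have a₆ := abs_le.1 (le_refl |y₂ - z₂|)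
  have a₇ := abs_le.1 (le_refl |x₁ - w₁|)
  have a₈ := abs_le.1 (le_refl |x₂ - w₂|)
  rcases abs_choice (x₁ - y₁) with e₁ | e₁ <;> rcases abs_choice (x₂ - y₂) with e₂ | e₂ <;>
    rcases abs_choice (z₁ - w₁) with e₃ | e₃ <;> rcases abs_choice (z₂ - w₂) with e₄ | e₄ <;>
    rw [e₁, e₂, e₃, e₄] at h₁ h₂ <;> clear e₁ e₂ e₃ e₄ <;>
    first
    | linarith
    | rcases hx with hx | hx <;> rcases hy with hy | hy <;> rcases hz with hz | hz <;>
        rcases hw with hw | hw <;> linarith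

theorem isDeltaHyp : IsDeltaHyp (graph k) k := by
  intro w x y z
  have h := four_point x y z w
  rify at h
  simp only [gp, cast_dist]
  push_cast
  rw [ge_iff_le, sub_le_iff_le_add, min_le_iff]
  rcases max_choice
    (|(x.fst : ℝ) - z.fst| + |(x.snd : ℝ) - z.snd| + (|(y.fst : ℝ) - w.fst| + |(y.snd : ℝ) - w.snd|))
    (|(y.fst : ℝ) - z.fst| + |(y.snd : ℝ) - z.snd| + (|(x.fst : ℝ) - w.fst| + |(x.snd : ℝ) - w.snd|))
    with e | e <;> rw [e] at h
  · left; linarith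
  · right; linarith

theorem le_of_isDeltaHyp {δ : ℝ} (h : IsDeltaHyp (graph k) δ) : (k : ℝ) ≤ δ := by
  have h := h (mk k (2 * k) (by omega)) (root k) (mk 0 k (by omega)) (mk 0 0 (by omega))
  have hk : (0 : ℝ) ≤ k := k.cast_nonneg
  simp only [gp, cast_dist, root, fst_mk, snd_mk] at h
  push_cast at h
  rw [show (2 * k - k : ℝ) = k by ring, show (k - 2 * k : ℝ) = -k by ring] at h
  simp [abs_of_nonneg hk] at h
  rcases h with h | h <;> linarith

theorem hyperbolicity_graph : hyperbolicity (graph k) = k :=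
  IsLeast.csInf_eq ⟨⟨k.cast_nonneg, isDeltaHyp⟩, fun _ h => le_of_isDeltaHyp h.2⟩

/-- The neighbour of `p` towards the root: left of the missing quarter go down first,
elsewhere go right first. -/
def parent (p : LShape k) : LShape k :=
  if h₁ : 0 < p.snd ∧ (p.fst < k ∨ p.fst = 2 * k) then
    mk p.fst (p.snd - 1) (by have := p.bounds; omega)
  else if h₂ : p.fst < 2 * k then
    mk (p.fst + 1) p.snd (by have := p.bounds; omega)
  else p

theorem parent_eq_down {p : LShape k} (h : 0 < p.snd ∧ (p.fst < k ∨ p.fst = 2 * k)) :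
    p.parent.fst = p.fst ∧ p.parent.snd = p.snd - 1 := by
  simp [parent, h]

theorem parent_eq_right {p : LShape k} (h : ¬(0 < p.snd ∧ (p.fst < k ∨ p.fst = 2 * k)))
    (h' : p.fst < 2 * k) : p.parent.fst = p.fst + 1 ∧ p.parent.snd = p.snd := by
  rw [parent, dif_neg h, dif_pos h']
  simp

theorem parent_spec {p : LShape k} (hp : p ≠ root k) :
    l1 p.parent p = 1 ∧ l1 (root k) p.parent + 1 = l1 (root k) p := by
  have hb := p.bounds
  have hne : ¬(p.fst = 2 * k ∧ p.snd = 0) := fun h => hp (ext h.1 h.2)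
  simp only [l1, root, fst_mk, snd_mk]
  by_cases h : 0 < p.snd ∧ (p.fst < k ∨ p.fst = 2 * k)
  · have := parent_eq_down h
    omega
  · have := parent_eq_right h (by omega)
    omega

def tree (k : ℕ) : BFSTree (graph k) (root k) where
  parent := parent
  parent_root := by simp [parent, root]
  adj_parent _ hp := (parent_spec hp).1
  dist_parent p hp := by simpa only [dist_eq] using (parent_spec hp).2

theorem iterate_parent_down (n : ℕ) (hn : n ≤ k) :
    parent^[n] (mk 0 k (by omega) : LShape k) = mk 0 (k - n) (by omega) := by
  induction n with
  | zero => simp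
  | succ n ih =>
    rw [Function.iterate_succ_apply', ih (by omega)]
    obtain ⟨h₁, h₂⟩ := parent_eq_down
      (p := (mk 0 (k - n) (by omega) : LShape k)) (by simp; omega)
    exact ext (by simp [h₁]) (by simp [h₂]; ring)

theorem iterate_parent_right (n : ℕ) (hn : n ≤ k) :
    parent^[n] (mk k (2 * k) (by omega) : LShape k) = mk (k + n) (2 * k) (by omega) := by
  induction n with
  | zero => simp
  | succ n ih =>
    rw [Function.iterate_succ_apply', ih (by omega)]
    obtain ⟨h₁, h₂⟩ := parent_eq_right
      (p := (mk (k + n) (2 * k) (by omega) : LShape k)) (by simp; omega) (by simp; omega)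
    exact ext (by simp [h₁]; ring) (by simp [h₂])

theorem dist_le_four_mul (u v : LShape k) : (graph k).dist u v ≤ 4 * k := by
  have := u.bounds
  have := v.bounds
  rw [dist_eq, l1]
  omega

theorem rootedInsize_tree : rootedInsize (graph k) (tree k) = 4 * k := by
  refine IsGreatest.csSup_eq ⟨⟨mk 0 k (by omega), mk k (2 * k) (by omega), ?_⟩, ?_⟩
  · have hgp : ⌊gp (graph k) (mk 0 k (by omega)) (mk k (2 * k) (by omega)) (root k)⌋₊ = 2 * k := by
      have hk : (0 : ℝ) ≤ k := k.cast_nonneg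
      have h : gp (graph k) (mk 0 k (by omega)) (mk k (2 * k) (by omega)) (root k) =
          (2 * k : ℕ) := by
        simp only [gp, cast_dist, root, fst_mk, snd_mk]
        push_cast
        rw [show (k - 2 * k : ℝ) = -k by ring]
        simp [abs_of_nonneg hk]
        ring
      rw [h, Nat.floor_natCast]
    have hx : (graph k).dist (root k) (mk 0 k (by omega)) - 2 * k = k := by
      simp only [dist_eq, l1, root, fst_mk, snd_mk]; omega
    have hy : (graph k).dist (root k) (mk k (2 * k) (by omega)) - 2 * k = k := by
      simp only [dist_eq, l1, root, fst_mk, snd_mk]; omega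
    rw [show 4 * (k : ℝ) = (4 * k : ℕ) by push_cast; rfl, Nat.cast_inj, hgp, treeVert, treeVert, hx, hy]
    simp only [tree, iterate_parent_down k le_rfl, iterate_parent_right k le_rfl, dist_eq, l1,
      fst_mk, snd_mk]
    omega
  · rintro _ ⟨x, y, rfl⟩
    exact_mod_cast dist_le_four_mul _ _

end LShape

/-- For every positive integer `k` there is a finite connected graph `H`, a vertex `w`, and a
BFS-tree `T` rooted at `w` with `δ(H) = k` and `ρ_{w,T}(H) = 4k`. -/
theorem exists_graph_hyp_eq_and_rootedInsize_eq_four_mul (k : ℕ) (hk : 0 < k) :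
    ∃ (V : Type) (_ : Fintype V) (G : SimpleGraph V) (w : V) (T : BFSTree G w),
      G.Connected ∧ hyperbolicity G = (k : ℝ) ∧ rootedInsize G T = 4 * (k : ℝ) :=
  ⟨LShape k, inferInstance, LShape.graph k, LShape.root k, LShape.tree k,
    LShape.connected_and_dist_eq.1, LShape.hyperbolicity_graph, LShape.rootedInsize_tree⟩

end HypPaper
end
end

section
/- For every positive integer k, there exists a finite connected graph G', a vertex w of G', and a BFS-tree T of G' rooted at w such that ρ_{w,T}(G') ≤ 2k and δ(G') = 4k. -/
open SimpleGraph

noncomputable section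

namespace HypPaper

variable {V : Type*}

/-- If `D` is a function decreasing by at most one along edges, and such that every `u ≠ v` has a
neighbour strictly closer to `v`, then `D` is the graph distance. -/
theorem reachable_and_dist_eq (G : SimpleGraph V) (D : V → V → ℕ)
    (self : ∀ u, D u u = 0)
    (lip : ∀ u u' v, G.Adj u u' → D u v ≤ D u' v + 1)
    (step : ∀ u v, u ≠ v → ∃ u', G.Adj u u' ∧ D u' v + 1 = D u v) (u v : V) :
    G.Reachable u v ∧ G.dist u v = D u v := by
  have lower : ∀ {u v : V} (p : G.Walk u v), D u v ≤ p.length := by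
    intro u v p
    induction p with
    | nil => simp [self]
    | cons h p ih =>
      rw [Walk.length_cons]
      exact (lip _ _ _ h).trans (by omega)
  have upper : ∀ n (u v : V), D u v = n → ∃ p : G.Walk u v, p.length = n := by
    intro n
    induction n with
    | zero =>
      intro u v h
      by_cases huv : u = v
      · subst huv
        exact ⟨Walk.nil, rfl⟩
      · obtain ⟨u', -, h'⟩ := step u v huv
        omega
    | succ n ih =>
      intro u v h
      have huv : u ≠ v := by
        rintro rfl
        rw [self] at h
        omega
      obtain ⟨u', ha, h'⟩ := step u v huv
      obtain ⟨p, hp⟩ := ih u' v (by omega)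
      exact ⟨Walk.cons ha p, by simp [hp]⟩
  obtain ⟨p, hp⟩ := upper _ u v rfl
  have hr : G.Reachable u v := ⟨p⟩
  obtain ⟨q, hq⟩ := hr.exists_walk_length_eq_dist
  exact ⟨hr, le_antisymm (hp ▸ dist_le p) (hq ▸ lower q)⟩

/-- The vertices of the square grid `[-n, n]²`. -/
abbrev GridVert (n : ℕ) : Type := Set.Icc (-n : ℤ) n × Set.Icc (-n : ℤ) n

namespace GridVert

variable {n : ℕ}

/-- The `ℓ₁`-distance on the grid. -/
def l1 (u v : GridVert n) : ℕ :=
  ((u.1 : ℤ) - v.1).natAbs + ((u.2 : ℤ) - v.2).natAbs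

theorem l1_comm (u v : GridVert n) : l1 u v = l1 v u := by
  unfold l1
  omega

/-- The square grid `[-n, n]²`. -/
def grid (n : ℕ) : SimpleGraph (GridVert n) where
  Adj u v := l1 u v = 1
  symm := ⟨fun u v h => by rw [l1_comm]; exact h⟩
  loopless := ⟨fun u h => by simp [l1] at h⟩

theorem ext_coe {u v : GridVert n} (h₁ : (u.1 : ℤ) = v.1) (h₂ : (u.2 : ℤ) = v.2) : u = v :=
  Prod.ext (Subtype.ext h₁) (Subtype.ext h₂)

theorem exists_adj_closer (u v : GridVert n) (h : u ≠ v) :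
    ∃ u', (grid n).Adj u u' ∧ l1 u' v + 1 = l1 u v := by
  obtain ⟨⟨a, ha⟩, ⟨b, hb⟩⟩ := u
  obtain ⟨⟨c, hc⟩, ⟨d, hd⟩⟩ := v
  rw [Set.mem_Icc] at ha hb hc hd
  simp only [grid, l1]
  rcases lt_trichotomy a c with hac | rfl | hac
  · exact ⟨(⟨a + 1, by constructor <;> omega⟩, ⟨b, hb⟩), by dsimp only; omega, by dsimp only; omega⟩
  · rcases lt_trichotomy b d with hbd | rfl | hbd
    · exact ⟨(⟨a, ha⟩, ⟨b + 1, by constructor <;> omega⟩), by dsimp only; omega,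
        by dsimp only; omega⟩
    · exact absurd rfl h
    · exact ⟨(⟨a, ha⟩, ⟨b - 1, by constructor <;> omega⟩), by dsimp only; omega,
        by dsimp only; omega⟩
  · exact ⟨(⟨a - 1, by constructor <;> omega⟩, ⟨b, hb⟩), by dsimp only; omega, by dsimp only; omega⟩

theorem grid_reachable_and_dist (u v : GridVert n) :
    (grid n).Reachable u v ∧ (grid n).dist u v = l1 u v := by
  refine reachable_and_dist_eq (grid n) l1 (fun u => by simp [l1]) ?_ exists_adj_closer u v
  intro u u' v h
  simp only [grid, l1] at h ⊢
  omega

theorem grid_dist (u v : GridVert n) : (grid n).dist u v = l1 u v :=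
  (grid_reachable_and_dist u v).2

/-- The centre of the grid. -/
def center (n : ℕ) : GridVert n := (⟨0, by simp⟩, ⟨0, by simp⟩)

theorem grid_connected (n : ℕ) : (grid n).Connected :=
  have : Nonempty (GridVert n) := ⟨center n⟩
  ⟨fun u v => (grid_reachable_and_dist u v).1⟩

/-- One step towards the origin in `ℤ`. -/
def shrink (a : Set.Icc (-n : ℤ) n) : Set.Icc (-n : ℤ) n :=
  ⟨a - Int.sign a, by
    obtain ⟨a, h₁, h₂⟩ := a
    rcases lt_trichotomy a 0 with h | rfl | h
    · simp only [Int.sign_eq_neg_one_of_neg h, Set.mem_Icc]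
      omega
    · simp
    · simp only [Int.sign_eq_one_of_pos h, Set.mem_Icc]
      omega⟩

theorem coe_shrink (a : Set.Icc (-n : ℤ) n) :
    (0 < (a : ℤ) ∧ (shrink a : ℤ) = a - 1) ∨ ((a : ℤ) < 0 ∧ (shrink a : ℤ) = a + 1) ∨
      ((a : ℤ) = 0 ∧ (shrink a : ℤ) = 0) := by
  rcases lt_trichotomy (a : ℤ) 0 with h | h | h
  · simp [shrink, Int.sign_eq_neg_one_of_neg h, h]
  · simp [shrink, h]
  · simp [shrink, Int.sign_eq_one_of_pos h, h]

/-- The parent of a vertex: shrink a coordinate of largest absolute value, so that the root paths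
follow the diagonals as long as possible. -/
def gridParent (u : GridVert n) : GridVert n :=
  if (u.2 : ℤ).natAbs ≤ (u.1 : ℤ).natAbs then (shrink u.1, u.2) else (u.1, shrink u.2)

theorem l1_center (u : GridVert n) :
    l1 u (center n) = (u.1 : ℤ).natAbs + (u.2 : ℤ).natAbs := by
  simp [l1, center]

theorem eq_center_of_l1 {u : GridVert n} (h : l1 u (center n) = 0) : u = center n := by
  rw [l1_center] at h
  exact ext_coe (by simp only [center]; omega) (by simp only [center]; omega)

theorem l1_gridParent (u : GridVert n) (h : u ≠ center n) :
    l1 (gridParent u) u = 1 ∧ l1 (gridParent u) (center n) + 1 = l1 u (center n) := by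
  have h0 : l1 u (center n) ≠ 0 := fun h' => h (eq_center_of_l1 h')
  simp only [l1_center] at h0 ⊢
  unfold gridParent l1
  have h₁ := coe_shrink u.1
  have h₂ := coe_shrink u.2
  split_ifs <;> dsimp only <;> omega

/-- The diagonal BFS-tree of the grid rooted at its centre. -/
def gridTree (n : ℕ) : BFSTree (grid n) (center n) where
  parent := gridParent
  parent_root := by
    have h : shrink (center n).1 = (center n).1 := by
      apply Subtype.ext
      simp [shrink, center]
    unfold gridParent
    rw [if_pos (by simp [center]), h]
  adj_parent x hx := (l1_gridParent x hx).1
  dist_parent x hx := by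
    rw [grid_dist, grid_dist, l1_comm, l1_comm _ x]
    exact (l1_gridParent x hx).2

/-- `c` lies between `0` and `a`. -/
def Btw (c a : ℤ) : Prop := (0 ≤ c ∧ c ≤ a) ∨ (a ≤ c ∧ c ≤ 0)

theorem btw_self (a : ℤ) : Btw a a := by
  unfold Btw
  omega

theorem Btw.shrink {c : Set.Icc (-n : ℤ) n} {a : ℤ} (h : Btw c a) :
    Btw (GridVert.shrink c) a := by
  have := coe_shrink c
  unfold Btw at h ⊢
  omega

theorem natAbs_shrink {a : Set.Icc (-n : ℤ) n} (h : (a : ℤ).natAbs ≠ 0) :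
    (shrink a : ℤ).natAbs + 1 = (a : ℤ).natAbs := by
  have := coe_shrink a
  omega

theorem iterate_gridParent (x : GridVert n) (i : ℕ) (hi : i ≤ l1 x (center n)) :
    Btw (gridParent^[i] x).1 x.1 ∧ Btw (gridParent^[i] x).2 x.2 ∧
      l1 (gridParent^[i] x) (center n) + i = l1 x (center n) ∧
      (((gridParent^[i] x).1 : ℤ).natAbs ≤ ((gridParent^[i] x).2 : ℤ).natAbs ∨
        ((gridParent^[i] x).2 : ℤ) = x.2) ∧
      (((gridParent^[i] x).2 : ℤ).natAbs ≤ ((gridParent^[i] x).1 : ℤ).natAbs + 1 ∨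
        ((gridParent^[i] x).1 : ℤ) = x.1) := by
  induction i with
  | zero => exact ⟨btw_self _, btw_self _, rfl, Or.inr rfl, Or.inr rfl⟩
  | succ i ih =>
    obtain ⟨b₁, b₂, hl, h₁, h₂⟩ := ih (by omega)
    rw [Function.iterate_succ_apply']
    generalize gridParent^[i] x = z at *
    rw [l1_center z] at hl
    rw [l1_center (gridParent z)]
    unfold gridParent
    split_ifs with h
    · have hs := natAbs_shrink (a := z.1) (by omega)
      exact ⟨b₁.shrink, b₂, by dsimp only; omega, h₁.imp_left fun _ => by dsimp only; omega,
        Or.inl (by dsimp only; omega)⟩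
    · have hs := natAbs_shrink (a := z.2) (by omega)
      exact ⟨b₁, b₂.shrink, by dsimp only; omega, Or.inl (by dsimp only; omega),
        h₂.imp_left fun _ => by dsimp only; omega⟩

theorem Btw.natAbs_le {c a : ℤ} (h : Btw c a) : c.natAbs ≤ a.natAbs := by
  unfold Btw at h
  omega

/-- Either `a` and `b` have the same sign, or they have opposite signs. -/
theorem Btw.natAbs_sub {c a d b : ℤ} (h : Btw c a) (h' : Btw d b) :
    ((c - d).natAbs + 2 * min c.natAbs d.natAbs = c.natAbs + d.natAbs ∧
      (a - b).natAbs + 2 * min a.natAbs b.natAbs = a.natAbs + b.natAbs) ∨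
    ((c - d).natAbs = c.natAbs + d.natAbs ∧ (a - b).natAbs = a.natAbs + b.natAbs) := by
  unfold Btw at h h'
  rcases h with ⟨h₁, h₂⟩ | ⟨h₁, h₂⟩ <;> rcases h' with ⟨h₃, h₄⟩ | ⟨h₃, h₄⟩
  · left; constructor <;> omega
  · right; constructor <;> omega
  · right; constructor <;> omega
  · left; constructor <;> omega

theorem path_coord_le {k r a b c A B C D : ℕ} (hb : b ≤ 2 * k) (hr : r ≤ c + b)
    (ha : a ≤ 2 * k)
    (hu : A + B = r) (hud : A ≤ B ∨ B = b) (hA : A ≤ a)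
    (hv : C + D = r) (hvd : D ≤ C + 1 ∨ C = c) : A ≤ C + k := by
  rcases hud with hud | hud <;> rcases hvd with hvd | hvd <;> omega

/-- Points of two root paths at a common level `r ≤ (x|y)` are at distance at most `2k`. -/
theorem natAbs_path_le {k r : ℕ} {x₁ x₂ y₁ y₂ u₁ u₂ v₁ v₂ : ℤ}
    (hx₁ : x₁.natAbs ≤ 2 * k) (hx₂ : x₂.natAbs ≤ 2 * k)
    (hy₁ : y₁.natAbs ≤ 2 * k) (hy₂ : y₂.natAbs ≤ 2 * k)
    (hr : 2 * r + ((x₁ - y₁).natAbs + (x₂ - y₂).natAbs) ≤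
      (x₁.natAbs + x₂.natAbs) + (y₁.natAbs + y₂.natAbs))
    (hu₁ : Btw u₁ x₁) (hu₂ : Btw u₂ x₂) (hu : u₁.natAbs + u₂.natAbs = r)
    (hud : u₁.natAbs ≤ u₂.natAbs ∨ u₂ = x₂) (hud' : u₂.natAbs ≤ u₁.natAbs + 1 ∨ u₁ = x₁)
    (hv₁ : Btw v₁ y₁) (hv₂ : Btw v₂ y₂) (hv : v₁.natAbs + v₂.natAbs = r)
    (hvd : v₁.natAbs ≤ v₂.natAbs ∨ v₂ = y₂) (hvd' : v₂.natAbs ≤ v₁.natAbs + 1 ∨ v₁ = y₁) :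
    (u₁ - v₁).natAbs + (u₂ - v₂).natAbs ≤ 2 * k := by
  have s₁ := hu₁.natAbs_sub hv₁
  have s₂ := hu₂.natAbs_sub hv₂
  replace hud := hud.imp_right (congrArg Int.natAbs)
  replace hud' := hud'.imp_right (congrArg Int.natAbs)
  replace hvd := hvd.imp_right (congrArg Int.natAbs)
  replace hvd' := hvd'.imp_right (congrArg Int.natAbs)
  replace hu₁ := hu₁.natAbs_le
  replace hu₂ := hu₂.natAbs_le
  replace hv₁ := hv₁.natAbs_le
  replace hv₂ := hv₂.natAbs_le
  generalize (u₁ - v₁).natAbs = e₁ at *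
  generalize (u₂ - v₂).natAbs = e₂ at *
  generalize (x₁ - y₁).natAbs = f₁ at *
  generalize (x₂ - y₂).natAbs = f₂ at *
  generalize x₁.natAbs = a at *
  generalize x₂.natAbs = b at *
  generalize y₁.natAbs = c at *
  generalize y₂.natAbs = d at *
  generalize u₁.natAbs = A at *
  generalize u₂.natAbs = B at *
  generalize v₁.natAbs = C at *
  generalize v₂.natAbs = D at *
  rcases s₁ with ⟨s₁, t₁⟩ | ⟨s₁, t₁⟩ <;> rcases s₂ with ⟨s₂, t₂⟩ | ⟨s₂, t₂⟩
  · have hr' : r ≤ min a c + min b d := by omega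
    have h₁ : A ≤ C + k := path_coord_le hx₂ (by omega) hx₁ hu hud hu₁ hv hvd'
    have h₂ : C ≤ A + k := path_coord_le hy₂ (by omega) hy₁ hv hvd hv₁ hu hud'
    clear hud hud' hvd hvd' hr t₁ t₂
    omega
  · have hB : B ≤ k := by clear hud hvd hvd'; omega
    have hD : D ≤ k := by clear hud hvd hud'; omega
    clear hud hud' hvd hvd'
    omega
  · have hA : A ≤ k := by clear hud' hvd hvd'; omega
    have hC : C ≤ k := by clear hud hvd' hud'; omega
    clear hud hud' hvd hvd'
    omega
  · clear hud hud' hvd hvd'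
    omega

theorem treeVert_gridTree (x : GridVert n) (r : ℕ) :
    treeVert (grid n) (gridTree n) x r = gridParent^[l1 x (center n) - r] x := by
  rw [treeVert, grid_dist, l1_comm]
  rfl

theorem natAbs_coe_le (a : Set.Icc (-n : ℤ) n) : (a : ℤ).natAbs ≤ n := by
  obtain ⟨a, h₁, h₂⟩ := a
  dsimp only
  omega

theorem l1_triangle (x y z : GridVert n) : l1 x z ≤ l1 x y + l1 y z := by
  unfold l1
  omega

theorem gp_grid (x y w : GridVert n) :
    gp (grid n) x y w = ((l1 x w : ℝ) + l1 y w - l1 x y) / 2 := by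
  simp only [gp, grid_dist]

theorem rootedInsize_gridTree_le (k : ℕ) :
    rootedInsize (grid (2 * k)) (gridTree (2 * k)) ≤ 2 * (k : ℝ) := by
  refine Real.sSup_le ?_ (by positivity)
  rintro _ ⟨x, y, rfl⟩
  have htri := l1_triangle x y (center (2 * k))
  have htri' := l1_triangle y x (center (2 * k))
  have htri'' := l1_triangle x (center (2 * k)) y
  rw [l1_comm y x] at htri'
  rw [l1_comm (center _) y] at htri''
  have hfloor : 2 * ⌊gp (grid (2 * k)) x y (center (2 * k))⌋₊ + l1 x y ≤
      l1 x (center (2 * k)) + l1 y (center (2 * k)) := by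
    have h0 : 0 ≤ gp (grid (2 * k)) x y (center (2 * k)) := by
      have : (l1 x y : ℝ) ≤ l1 x (center (2 * k)) + l1 y (center (2 * k)) := by
        exact_mod_cast htri''
      rw [gp_grid]
      linarith
    have h := Nat.floor_le h0
    rw [gp_grid] at h
    rw [gp_grid]
    have h' : 2 * (⌊((l1 x (center (2 * k)) : ℝ) + l1 y (center (2 * k)) - l1 x y) / 2⌋₊ : ℝ) +
        l1 x y ≤ l1 x (center (2 * k)) + l1 y (center (2 * k)) := by
      linarith
    exact_mod_cast h'
  set r := ⌊gp (grid (2 * k)) x y (center (2 * k))⌋₊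
  rw [treeVert_gridTree, treeVert_gridTree, grid_dist]
  obtain ⟨hu₁, hu₂, hu, hud, hud'⟩ := iterate_gridParent x (l1 x (center (2 * k)) - r) (by omega)
  obtain ⟨hv₁, hv₂, hv, hvd, hvd'⟩ := iterate_gridParent y (l1 y (center (2 * k)) - r) (by omega)
  have hu' : l1 (gridParent^[l1 x (center (2 * k)) - r] x) (center (2 * k)) = r := by omega
  have hv' : l1 (gridParent^[l1 y (center (2 * k)) - r] y) (center (2 * k)) = r := by omega
  rw [l1_center] at hu' hv'
  rw [l1_center x, l1_center y] at hfloor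
  have := natAbs_path_le (natAbs_coe_le x.1) (natAbs_coe_le x.2) (natAbs_coe_le y.1)
    (natAbs_coe_le y.2) hfloor hu₁ hu₂ hu' hud hud' hv₁ hv₂ hv' hvd hvd'
  exact_mod_cast this

theorem natAbs_four_point (x y z w : ℤ) :
    (x - y).natAbs + (z - w).natAbs ≤ (x - z).natAbs + (y - w).natAbs ∨
      (x - y).natAbs + (z - w).natAbs ≤ (y - z).natAbs + (x - w).natAbs := by
  omega

theorem natAbs_coe_sub_le (a b : Set.Icc (-n : ℤ) n) : ((a : ℤ) - b).natAbs ≤ 2 * n := by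
  have ha := natAbs_coe_le a
  have hb := natAbs_coe_le b
  omega

theorem l1_four_point (x y z w : GridVert n) :
    l1 x y + l1 z w ≤ max (l1 x z + l1 y w) (l1 y z + l1 x w) + 4 * n := by
  have h₁ := natAbs_four_point x.1 y.1 z.1 w.1
  have h₂ := natAbs_four_point x.2 y.2 z.2 w.2
  have a₁ := natAbs_coe_sub_le x.1 y.1
  have a₂ := natAbs_coe_sub_le x.2 y.2
  have b₁ := natAbs_coe_sub_le z.1 w.1
  have b₂ := natAbs_coe_sub_le z.2 w.2
  rw [← tsub_le_iff_right, le_max_iff]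
  unfold l1
  generalize ((x.1 : ℤ) - y.1).natAbs = p₁ at *
  generalize ((x.2 : ℤ) - y.2).natAbs = p₂ at *
  generalize ((z.1 : ℤ) - w.1).natAbs = q₁ at *
  generalize ((z.2 : ℤ) - w.2).natAbs = q₂ at *
  generalize ((x.1 : ℤ) - z.1).natAbs = s₁ at *
  generalize ((x.2 : ℤ) - z.2).natAbs = s₂ at *
  generalize ((y.1 : ℤ) - w.1).natAbs = t₁ at *
  generalize ((y.2 : ℤ) - w.2).natAbs = t₂ at *
  generalize ((y.1 : ℤ) - z.1).natAbs = i₁ at *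
  generalize ((y.2 : ℤ) - z.2).natAbs = i₂ at *
  generalize ((x.1 : ℤ) - w.1).natAbs = j₁ at *
  generalize ((x.2 : ℤ) - w.2).natAbs = j₂ at *
  omega

theorem isDeltaHyp_grid (n : ℕ) : IsDeltaHyp (grid n) (2 * n) := by
  intro w x y z
  have h : (l1 x y : ℝ) + l1 z w ≤
      max ((l1 x z : ℝ) + l1 y w) (l1 y z + l1 x w) + 4 * n := by
    exact_mod_cast l1_four_point x y z w
  simp only [gp_grid, ge_iff_le, sub_le_iff_le_add]
  rcases le_total ((l1 x z : ℝ) + l1 y w) (l1 y z + l1 x w) with h' | h'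
  · rw [max_eq_right h'] at h
    exact (min_le_right _ _).trans (by linarith)
  · rw [max_eq_left h'] at h
    exact (min_le_left _ _).trans (by linarith)

theorem le_of_isDeltaHyp_grid {δ : ℝ} (h : IsDeltaHyp (grid n) δ) : 2 * (n : ℝ) ≤ δ := by
  let lo : Set.Icc (-n : ℤ) n := ⟨-n, by constructor <;> omega⟩
  let hi : Set.Icc (-n : ℤ) n := ⟨n, by constructor <;> omega⟩
  have hlo : ((lo : ℤ) - lo).natAbs = 0 := by simp
  have hhi : ((hi : ℤ) - hi).natAbs = 0 := by simp
  have hlh : ((lo : ℤ) - hi).natAbs = 2 * n := by simp only [lo, hi]; omega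
  have hhl : ((hi : ℤ) - lo).natAbs = 2 * n := by simp only [lo, hi]; omega
  have := h (lo, lo) (lo, hi) (hi, lo) (hi, hi)
  simp only [gp_grid, l1, hlo, hhi, hlh, hhl, ge_iff_le] at this
  push_cast at this
  rw [min_eq_left (by linarith)] at this
  linarith

theorem hyperbolicity_grid (n : ℕ) : hyperbolicity (grid n) = 2 * (n : ℝ) :=
  IsLeast.csInf_eq ⟨⟨by positivity, isDeltaHyp_grid n⟩, fun _ h => le_of_isDeltaHyp_grid h.2⟩

end GridVert

/-- For every positive integer `k` there is a finite connected graph `G'`, a vertex `w`, and a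
BFS-tree `T` rooted at `w` with `ρ_{w,T}(G') ≤ 2k` and `δ(G') = 4k`. -/
theorem exists_graph_rootedInsize_le_and_hyp_eq (k : ℕ) (hk : 0 < k) :
    ∃ (V : Type) (_ : Fintype V) (G : SimpleGraph V) (w : V) (T : BFSTree G w),
      G.Connected ∧ rootedInsize G T ≤ 2 * (k : ℝ) ∧ hyperbolicity G = 4 * (k : ℝ) := by
  refine ⟨GridVert (2 * k), inferInstance, GridVert.grid (2 * k), GridVert.center (2 * k),
    GridVert.gridTree (2 * k), GridVert.grid_connected _, GridVert.rootedInsize_gridTree_le k, ?_⟩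
  rw [GridVert.hyperbolicity_grid]
  push_cast
  ring

end HypPaper
end
end
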